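/- Let p > 2. There exists a constant C > 0 such that for every ε ∈ (0, 1] and every smooth compactly supported f: ℝ³ → ℝ, ∫ f² dμ ≤ C ( ε ∫ |∇_ℍ f|² dμ + ε⁻¹ ∫ |x|² f² dμ ). -/

import Mathlib

open MeasureTheory

/-- Horizontal vector field `X₁ = ∂_{x₁} - (x₂/2) ∂_t` on the Heisenberg group `ℝ³`. -/
noncomputable def X1 (f : ℝ × ℝ × ℝ → ℝ) (w : ℝ × ℝ × ℝ) : ℝ :=
  fderiv ℝ f w (1, 0, -(w.2.1) / 2)

/-- Horizontal vector field `X₂ = ∂_{x₂} + (x₁/2) ∂_t` on the Heisenberg group `ℝ³`. -/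
noncomputable def X2 (f : ℝ × ℝ × ℝ → ℝ) (w : ℝ × ℝ × ℝ) : ℝ :=
  fderiv ℝ f w (0, 1, w.1 / 2)

/-- The Kaplan norm `N(x₁,x₂,t) = ((x₁² + x₂²)² + 16 t²)^{1/4}` on the Heisenberg group. -/
noncomputable def KaplanH (w : ℝ × ℝ × ℝ) : ℝ :=
  ((w.1 ^ 2 + w.2.1 ^ 2) ^ 2 + 16 * w.2.2 ^ 2) ^ ((1 : ℝ) / 4)

/-- The probability measure `dμ = Z⁻¹ e^{-N^p} dξ` on the Heisenberg group `ℝ³`. -/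
noncomputable def muH (p : ℝ) : Measure (ℝ × ℝ × ℝ) :=
  volume.withDensity (fun w => ENNReal.ofReal
    ((∫ v : ℝ × ℝ × ℝ, Real.exp (-(KaplanH v) ^ p))⁻¹ * Real.exp (-(KaplanH w) ^ p)))

/-- The fourth power of the Kaplan norm. -/
noncomputable def kaplanFour (w : ℝ × ℝ × ℝ) : ℝ :=
  (w.1 ^ 2 + w.2.1 ^ 2) ^ 2 + 16 * w.2.2 ^ 2

lemma kaplanFour_nonneg (w : ℝ × ℝ × ℝ) : 0 ≤ kaplanFour w := by
  unfold kaplanFour; positivity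

lemma contDiff_kaplanFour {n : WithTop ℕ∞} : ContDiff ℝ n kaplanFour := by
  unfold kaplanFour; fun_prop

lemma kaplanH_rpow (w : ℝ × ℝ × ℝ) (p : ℝ) : KaplanH w ^ p = kaplanFour w ^ (p / 4) := by
  unfold KaplanH
  rw [← kaplanFour, ← Real.rpow_mul (kaplanFour_nonneg w)]
  ring_nf

lemma continuous_exp_neg_kaplanFour_rpow {q : ℝ} (hq : 0 ≤ q) (δ : ℝ) :
    Continuous fun w => Real.exp (-(kaplanFour w + δ) ^ q) := by
  have := (contDiff_kaplanFour (n := 0)).continuous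
  exact Real.continuous_exp.comp ((this.add continuous_const).rpow_const fun _ => Or.inr hq).neg

/-- Upper bound for `ΔV / 2 - |∇V|² / 4`, where `V = u ^ q` and `u = m + δ`, with `m` standing for
the fourth power of the Kaplan norm and `s` for `|x|²`. -/
lemma laplacian_sub_gradient_le {q : ℝ} (hq : 1 / 2 < q) {m δ s : ℝ} (hδ : 0 < δ) (hδ1 : δ ≤ 1)
    (hs : 0 ≤ s) (hsm : s ^ 2 ≤ m) :
    (q * (m + δ) ^ (q - 1) * (24 * s) + q * (q - 1) * (m + δ) ^ (q - 2) * (16 * s * m)) / 2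
      - (q * (m + δ) ^ (q - 1)) ^ 2 * (16 * s * m) / 4
      ≤ (256 : ℝ) ^ (q - 1 / 2) * (12 * q + 8 * q ^ 2) := by
  have hm : 0 ≤ m := (sq_nonneg s).trans hsm
  set u := m + δ with hu
  have hu0 : 0 < u := by positivity
  have h1 : u ^ (q - 1) = u ^ q / u := by rw [Real.rpow_sub hu0, Real.rpow_one]
  have h2 : u ^ (q - 2) = u ^ q / u ^ 2 := by
    rw [Real.rpow_sub hu0]; norm_cast
  set a := u ^ q with ha
  have ha0 : 0 < a := by positivity
  set θ := m / u with hθ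
  have hθ0 : 0 ≤ θ := by positivity
  have hθ1 : θ ≤ 1 := by rw [hθ, div_le_one hu0]; linarith
  have hmθ : m = θ * u := by rw [hθ]; field_simp
  have key : (q * (u ^ (q - 1)) * (24 * s) + q * (q - 1) * (u ^ (q - 2)) * (16 * s * m)) / 2
      - (q * u ^ (q - 1)) ^ 2 * (16 * s * m) / 4
      = a / u * s * (12 * q + 8 * q * (q - 1) * θ - 4 * q ^ 2 * (a * θ)) := by
    rw [h1, h2, hmθ]; field_simp; ring
  rw [key]
  have hθq : 8 * q * (q - 1) * θ ≤ 8 * q ^ 2 := by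
    nlinarith [mul_nonneg (show 0 ≤ q by linarith) hθ0,
      mul_nonneg (sq_nonneg q) (sub_nonneg.2 hθ1)]
  rcases le_total u 256 with h | h
  · have hbr : 12 * q + 8 * q * (q - 1) * θ - 4 * q ^ 2 * (a * θ) ≤ 12 * q + 8 * q ^ 2 := by
      have : 0 ≤ 4 * q ^ 2 * (a * θ) := by positivity
      linarith
    have hsu : s ≤ u ^ (1 / 2 : ℝ) := by
      rw [← Real.sqrt_eq_rpow]
      exact Real.le_sqrt_of_sq_le (by linarith)
    have hle : a / u * s ≤ (256 : ℝ) ^ (q - 1 / 2) := by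
      calc a / u * s ≤ a / u * u ^ (1 / 2 : ℝ) := by gcongr
        _ = u ^ (q - 1 / 2) := by
          rw [← h1, ← Real.rpow_add hu0]; ring_nf
        _ ≤ _ := Real.rpow_le_rpow hu0.le h (by linarith)
    calc _ ≤ a / u * s * (12 * q + 8 * q ^ 2) := by gcongr
      _ ≤ _ := by gcongr
  · have hθ2 : 1 / 2 ≤ θ := by rw [hθ, div_le_div_iff₀ (by norm_num) hu0]; linarith
    have ha16 : 16 ≤ a := by
      calc (16 : ℝ) = Real.sqrt 256 := by
            rw [show (256 : ℝ) = 16 ^ 2 by norm_num, Real.sqrt_sq (by norm_num)]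
        _ ≤ Real.sqrt u := Real.sqrt_le_sqrt h
        _ = u ^ (1 / 2 : ℝ) := Real.sqrt_eq_rpow u
        _ ≤ a := Real.rpow_le_rpow_of_exponent_le (by linarith) hq.le
    have haθ : 8 ≤ a * θ := by nlinarith
    have hbr : 12 * q + 8 * q * (q - 1) * θ - 4 * q ^ 2 * (a * θ) ≤ 0 := by
      nlinarith [mul_nonneg (sq_nonneg q) (sub_nonneg.2 haθ)]
    have : a / u * s * (12 * q + 8 * q * (q - 1) * θ - 4 * q ^ 2 * (a * θ)) ≤ 0 :=
      mul_nonpos_of_nonneg_of_nonpos (by positivity) hbr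
    exact this.trans (by positivity)

instance isAddHaarMeasure_volume_real_prod :
    (volume : Measure (ℝ × ℝ × ℝ)).IsAddHaarMeasure :=
  haveI : (volume : Measure (ℝ × ℝ)).IsAddHaarMeasure :=
    Measure.prod.instIsAddHaarMeasure volume volume
  Measure.prod.instIsAddHaarMeasure volume volume

lemma integral_mul_fderiv_eq_zero {g H : ℝ × ℝ × ℝ → ℝ} {v : ℝ × ℝ × ℝ}
    (hg : ContDiff ℝ 1 g) (hH : ContDiff ℝ 1 H) (hc : HasCompactSupport H)
    (hgv : ∀ w, fderiv ℝ g w v = 0) : ∫ w, g w * fderiv ℝ H w v = 0 := by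
  have hd : Continuous fun w => fderiv ℝ H w v :=
    (hH.continuous_fderiv one_ne_zero).clm_apply continuous_const
  rw [integral_mul_fderiv_eq_neg_fderiv_mul_of_integrable]
  · simp [hgv]
  · simp [hgv]
  · exact (hg.continuous.mul hd).integrable_of_hasCompactSupport (hc.fderiv_apply ℝ v).mul_left
  · exact (hg.continuous.mul hH.continuous).integrable_of_hasCompactSupport hc.mul_left
  · exact fun w _ => hg.differentiable one_ne_zero w
  · exact fun w _ => hH.differentiable one_ne_zero w

lemma X1_eq (H : ℝ × ℝ × ℝ → ℝ) (w : ℝ × ℝ × ℝ) :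
    X1 H w = 1 * fderiv ℝ H w (1, 0, 0) + -(w.2.1) / 2 * fderiv ℝ H w (0, 0, 1) := by
  rw [X1, one_mul, ← smul_eq_mul, ← map_smul, ← map_add]
  simp

lemma X2_eq (H : ℝ × ℝ × ℝ → ℝ) (w : ℝ × ℝ × ℝ) :
    X2 H w = 1 * fderiv ℝ H w (0, 1, 0) + w.1 / 2 * fderiv ℝ H w (0, 0, 1) := by
  rw [X2, one_mul, ← smul_eq_mul, ← map_smul, ← map_add]
  simp

lemma continuous_X1 {H : ℝ × ℝ × ℝ → ℝ} (hH : ContDiff ℝ 1 H) : Continuous (X1 H) := by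
  unfold X1
  exact (hH.continuous_fderiv one_ne_zero).clm_apply (by fun_prop)

lemma continuous_X2 {H : ℝ × ℝ × ℝ → ℝ} (hH : ContDiff ℝ 1 H) : Continuous (X2 H) := by
  unfold X2
  exact (hH.continuous_fderiv one_ne_zero).clm_apply (by fun_prop)

lemma hasCompactSupport_X1 {H : ℝ × ℝ × ℝ → ℝ} (hc : HasCompactSupport H) :
    HasCompactSupport (X1 H) :=
  (hc.fderiv ℝ).mono fun w hw h => hw (by simp [X1, h])

lemma hasCompactSupport_X2 {H : ℝ × ℝ × ℝ → ℝ} (hc : HasCompactSupport H) :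
    HasCompactSupport (X2 H) :=
  (hc.fderiv ℝ).mono fun w hw h => hw (by simp [X2, h])

lemma integrable_mul_fderiv {g H : ℝ × ℝ × ℝ → ℝ} (v : ℝ × ℝ × ℝ)
    (hg : Continuous g) (hH : ContDiff ℝ 1 H) (hc : HasCompactSupport H) :
    Integrable fun w => g w * fderiv ℝ H w v :=
  (hg.mul ((hH.continuous_fderiv one_ne_zero).clm_apply
    continuous_const)).integrable_of_hasCompactSupport (hc.fderiv_apply ℝ v).mul_left

lemma integral_X1_eq_zero {H : ℝ × ℝ × ℝ → ℝ} (hH : ContDiff ℝ 1 H)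
    (hc : HasCompactSupport H) : ∫ w, X1 H w = 0 := by
  simp_rw [X1_eq]
  rw [integral_add (integrable_mul_fderiv _ continuous_const hH hc)
      (integrable_mul_fderiv _ (by fun_prop) hH hc),
    integral_mul_fderiv_eq_zero contDiff_const hH hc (by simp),
    integral_mul_fderiv_eq_zero (g := fun w => -(w.2.1) / 2) (by fun_prop) hH hc, add_zero]
  intro w
  have : HasFDerivAt (fun w : ℝ × ℝ × ℝ => -(w.2.1) / 2)
      ((2⁻¹ : ℝ) • -((ContinuousLinearMap.fst ℝ ℝ ℝ).comp (ContinuousLinearMap.snd ℝ ℝ (ℝ × ℝ))))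
      w := by
    simp_rw [div_eq_mul_inv]
    exact (hasFDerivAt_snd.fst.neg).mul_const _
  simp [this.fderiv]

lemma integral_X2_eq_zero {H : ℝ × ℝ × ℝ → ℝ} (hH : ContDiff ℝ 1 H)
    (hc : HasCompactSupport H) : ∫ w, X2 H w = 0 := by
  simp_rw [X2_eq]
  rw [integral_add (integrable_mul_fderiv _ continuous_const hH hc)
      (integrable_mul_fderiv _ (by fun_prop) hH hc),
    integral_mul_fderiv_eq_zero contDiff_const hH hc (by simp),
    integral_mul_fderiv_eq_zero (g := fun w => w.1 / 2) (by fun_prop) hH hc, add_zero]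
  intro w
  have : HasFDerivAt (fun w : ℝ × ℝ × ℝ => w.1 / 2)
      ((2⁻¹ : ℝ) • ContinuousLinearMap.fst ℝ ℝ (ℝ × ℝ)) w := by
    simp_rw [div_eq_mul_inv]
    exact hasFDerivAt_fst.mul_const _
  simp [this.fderiv]

/-- `X₁` of the fourth power of the Kaplan norm. -/
noncomputable def kaplanFourX1 (w : ℝ × ℝ × ℝ) : ℝ :=
  4 * w.1 * (w.1 ^ 2 + w.2.1 ^ 2) - 16 * w.2.1 * w.2.2

/-- `X₂` of the fourth power of the Kaplan norm. -/
noncomputable def kaplanFourX2 (w : ℝ × ℝ × ℝ) : ℝ :=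
  4 * w.2.1 * (w.1 ^ 2 + w.2.1 ^ 2) + 16 * w.1 * w.2.2

/-- The field `f² e^{-V} (x - η ∇V / 2)`, `V = u ^ q`, in one component: `l` is the coordinate
and `P` the derivative of `u`. -/
noncomputable def hardyField (q δ η : ℝ) (f l P : ℝ × ℝ × ℝ → ℝ) (w : ℝ × ℝ × ℝ) : ℝ :=
  f w ^ 2 * Real.exp (-(kaplanFour w + δ) ^ q) *
    (l w - η / 2 * (q * (kaplanFour w + δ) ^ (q - 1) * P w))

section Field

variable {q δ η : ℝ} {f l P : ℝ × ℝ × ℝ → ℝ}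

lemma contDiff_hardyField (hδ : 0 < δ) (hf : ContDiff ℝ 1 f) (hl : ContDiff ℝ 1 l)
    (hP : ContDiff ℝ 1 P) : ContDiff ℝ 1 (hardyField q δ η f l P) := by
  have hu : ContDiff ℝ 1 fun w => kaplanFour w + δ := contDiff_kaplanFour.add contDiff_const
  have hne : ∀ w, kaplanFour w + δ ≠ 0 := fun w => by
    have := kaplanFour_nonneg w
    positivity
  have h1 := hu.rpow_const_of_ne (p := q) hne
  have h2 := hu.rpow_const_of_ne (p := q - 1) hne
  unfold hardyField
  fun_prop

lemma hasCompactSupport_hardyField (hc : HasCompactSupport f) :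
    HasCompactSupport (hardyField q δ η f l P) :=
  hc.mono fun w hw h => hw (by simp [hardyField, h])

lemma fderiv_hardyField (hδ : 0 < δ) (hf : ContDiff ℝ 1 f) (hl : ContDiff ℝ 1 l)
    (hP : ContDiff ℝ 1 P) {w v : ℝ × ℝ × ℝ} (hv : fderiv ℝ kaplanFour w v = P w)
    (hlv : fderiv ℝ l w v = 1) :
    fderiv ℝ (hardyField q δ η f l P) w v = Real.exp (-(kaplanFour w + δ) ^ q) *
      (2 * f w * fderiv ℝ f w v * (l w - η / 2 * (q * (kaplanFour w + δ) ^ (q - 1) * P w))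
      - f w ^ 2 * (q * (kaplanFour w + δ) ^ (q - 1) * P w) *
        (l w - η / 2 * (q * (kaplanFour w + δ) ^ (q - 1) * P w))
      + f w ^ 2 * (1 - η / 2 * (q * (q - 1) * (kaplanFour w + δ) ^ (q - 2) * P w ^ 2
        + q * (kaplanFour w + δ) ^ (q - 1) * fderiv ℝ P w v))) := by
  have along : ∀ {g : ℝ × ℝ × ℝ → ℝ}, ContDiff ℝ 1 g →
      HasLineDerivAt ℝ g (fderiv ℝ g w v) w v := fun hg =>
    (hg.differentiable one_ne_zero w).hasFDerivAt.hasLineDerivAt v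
  have hN := along (contDiff_kaplanFour (n := 1))
  rw [hv] at hN
  have hL := along hl
  rw [hlv] at hL
  have hF := along hf
  have hPP := along hP
  have hH := along (contDiff_hardyField (q := q) (η := η) hδ hf hl hP)
  unfold HasLineDerivAt at hN hL hF hPP hH
  have h0 : kaplanFour (w + (0 : ℝ) • v) + δ ≠ 0 := by
    have := kaplanFour_nonneg (w + (0 : ℝ) • v)
    positivity
  have hu := hN.add_const δ
  have hE := ((hu.rpow_const (p := q) (Or.inl h0)).neg).exp
  have hR := hu.rpow_const (p := q - 1) (Or.inl h0)
  have hD := ((hF.pow 2).mul hE).mul (hL.sub (((hR.const_mul q).mul hPP).const_mul (η / 2)))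
  rw [hH.unique hD]
  simp only [zero_smul, add_zero, Pi.mul_apply, Pi.pow_apply, Pi.neg_apply, Pi.sub_apply]
  rw [show q - 1 - 1 = q - 2 by ring]
  push_cast
  ring

end Field

section Integrands

variable {f : ℝ × ℝ × ℝ → ℝ}

lemma continuous_sq (hf : ContDiff ℝ 1 f) : Continuous fun w => f w ^ 2 :=
  hf.continuous.pow 2

lemma hasCompactSupport_sq (hc : HasCompactSupport f) : HasCompactSupport fun w => f w ^ 2 :=
  hc.mono fun w hw h => hw (by simp [h])

lemma continuous_gradSq (hf : ContDiff ℝ 1 f) : Continuous fun w => X1 f w ^ 2 + X2 f w ^ 2 :=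
  ((continuous_X1 hf).pow 2).add ((continuous_X2 hf).pow 2)

lemma hasCompactSupport_gradSq (hc : HasCompactSupport f) :
    HasCompactSupport fun w => X1 f w ^ 2 + X2 f w ^ 2 :=
  (hasCompactSupport_sq (hasCompactSupport_X1 hc)).add
    (hasCompactSupport_sq (hasCompactSupport_X2 hc))

lemma continuous_normSq_mul_sq (hf : ContDiff ℝ 1 f) :
    Continuous fun w : ℝ × ℝ × ℝ => (w.1 ^ 2 + w.2.1 ^ 2) * f w ^ 2 :=
  (by fun_prop : Continuous fun w : ℝ × ℝ × ℝ => w.1 ^ 2 + w.2.1 ^ 2).mul (continuous_sq hf)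

lemma hasCompactSupport_normSq_mul_sq (hc : HasCompactSupport f) :
    HasCompactSupport fun w : ℝ × ℝ × ℝ => (w.1 ^ 2 + w.2.1 ^ 2) * f w ^ 2 :=
  (hasCompactSupport_sq hc).mul_left

end Integrands

/-- The derivative of a function at `w` in direction `v`, computed along the line. -/
lemma fderiv_eq_of_hasDerivAt {g : ℝ × ℝ × ℝ → ℝ} {w v : ℝ × ℝ × ℝ} {d : ℝ}
    (hg : DifferentiableAt ℝ g w) (h : HasDerivAt (fun s : ℝ => g (w + s • v)) d 0) :
    fderiv ℝ g w v = d :=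
  (hg.hasFDerivAt.hasLineDerivAt v).unique h

lemma contDiff_kaplanFourX1 {n : WithTop ℕ∞} : ContDiff ℝ n kaplanFourX1 := by
  unfold kaplanFourX1; fun_prop

lemma contDiff_kaplanFourX2 {n : WithTop ℕ∞} : ContDiff ℝ n kaplanFourX2 := by
  unfold kaplanFourX2; fun_prop

/-- Derivative at `0` of the affine function `s ↦ a + s * b`. -/
lemma hasDerivAt_affine (a b : ℝ) : HasDerivAt (fun s : ℝ => a + s * b) b 0 := by
  simpa using ((hasDerivAt_id (0 : ℝ)).mul_const b).const_add a

lemma fderiv_kaplanFour (w v : ℝ × ℝ × ℝ) : fderiv ℝ kaplanFour w v =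
    4 * (w.1 ^ 2 + w.2.1 ^ 2) * (w.1 * v.1 + w.2.1 * v.2.1) + 32 * w.2.2 * v.2.2 := by
  refine fderiv_eq_of_hasDerivAt (contDiff_kaplanFour.differentiable one_ne_zero w) ?_
  have h1 := hasDerivAt_affine w.1 v.1
  have h2 := hasDerivAt_affine w.2.1 v.2.1
  have h3 := hasDerivAt_affine w.2.2 v.2.2
  refine ((((h1.pow 2).add (h2.pow 2)).pow 2).add ((h3.pow 2).const_mul 16)).congr_deriv ?_
  simp
  ring

lemma fderiv_kaplanFourX1 (w v : ℝ × ℝ × ℝ) : fderiv ℝ kaplanFourX1 w v =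
    4 * v.1 * (w.1 ^ 2 + w.2.1 ^ 2) + 8 * w.1 * (w.1 * v.1 + w.2.1 * v.2.1)
      - 16 * (v.2.1 * w.2.2 + w.2.1 * v.2.2) := by
  refine fderiv_eq_of_hasDerivAt (contDiff_kaplanFourX1.differentiable one_ne_zero w) ?_
  have h1 := hasDerivAt_affine w.1 v.1
  have h2 := hasDerivAt_affine w.2.1 v.2.1
  have h3 := hasDerivAt_affine w.2.2 v.2.2
  refine (((h1.const_mul 4).mul ((h1.pow 2).add (h2.pow 2))).sub
    ((h2.const_mul 16).mul h3)).congr_deriv ?_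
  simp
  ring

lemma fderiv_kaplanFourX2 (w v : ℝ × ℝ × ℝ) : fderiv ℝ kaplanFourX2 w v =
    4 * v.2.1 * (w.1 ^ 2 + w.2.1 ^ 2) + 8 * w.2.1 * (w.1 * v.1 + w.2.1 * v.2.1)
      + 16 * (v.1 * w.2.2 + w.1 * v.2.2) := by
  refine fderiv_eq_of_hasDerivAt (contDiff_kaplanFourX2.differentiable one_ne_zero w) ?_
  have h1 := hasDerivAt_affine w.1 v.1
  have h2 := hasDerivAt_affine w.2.1 v.2.1
  have h3 := hasDerivAt_affine w.2.2 v.2.2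
  refine (((h2.const_mul 4).mul ((h1.pow 2).add (h2.pow 2))).add
    ((h1.const_mul 16).mul h3)).congr_deriv ?_
  simp
  ring

/-- The algebraic core of the inequality: completing the square. Here `a, b` are the components
of `∇f`, `V₁, V₂` those of `∇V`, and `L₁, L₂` are the second derivatives of `V`. -/
lemma sq_le_of_laplacian_sub_gradient_le {η K g a b x y V₁ V₂ L₁ L₂ : ℝ} (hη : 0 < η)
    (hηK : η * K ≤ 1) (hV : (L₁ + L₂) / 2 - (V₁ ^ 2 + V₂ ^ 2) / 4 ≤ K) :
    g ^ 2 ≤ (2 * g * a * (x - η / 2 * V₁) - g ^ 2 * V₁ * (x - η / 2 * V₁)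
        + g ^ 2 * (1 - η / 2 * L₁))
      + (2 * g * b * (y - η / 2 * V₂) - g ^ 2 * V₂ * (y - η / 2 * V₂)
        + g ^ 2 * (1 - η / 2 * L₂))
      + η * (a ^ 2 + b ^ 2) + η⁻¹ * ((x ^ 2 + y ^ 2) * g ^ 2) := by
  have h1 : 0 ≤ η⁻¹ * ((η * a + g * (x - η / 2 * V₁)) ^ 2
      + (η * b + g * (y - η / 2 * V₂)) ^ 2) := by positivity
  have h2 : 0 ≤ g ^ 2 * (1 - η * ((L₁ + L₂) / 2 - (V₁ ^ 2 + V₂ ^ 2) / 4)) := by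
    refine mul_nonneg (sq_nonneg g) ?_
    have := mul_le_mul_of_nonneg_left hV hη.le
    linarith
  refine le_of_sub_nonneg ((add_nonneg h1 h2).trans_eq ?_)
  field_simp
  ring

/-- The pointwise inequality behind the Hardy inequality for the regularised weight. -/
lemma sq_mul_exp_le {q δ η : ℝ} (hq : 1 / 2 < q) (hδ : 0 < δ) (hδ1 : δ ≤ 1) (hη : 0 < η)
    (hηK : η * ((256 : ℝ) ^ (q - 1 / 2) * (12 * q + 8 * q ^ 2)) ≤ 1)
    {f : ℝ × ℝ × ℝ → ℝ} (hf : ContDiff ℝ 1 f) (w : ℝ × ℝ × ℝ) :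
    f w ^ 2 * Real.exp (-(kaplanFour w + δ) ^ q) ≤
      X1 (hardyField q δ η f (fun w => w.1) kaplanFourX1) w
      + X2 (hardyField q δ η f (fun w => w.2.1) kaplanFourX2) w
      + η * ((X1 f w ^ 2 + X2 f w ^ 2) * Real.exp (-(kaplanFour w + δ) ^ q))
      + η⁻¹ * (((w.1 ^ 2 + w.2.1 ^ 2) * f w ^ 2) * Real.exp (-(kaplanFour w + δ) ^ q)) := by
  have e1 := fderiv_hardyField (q := q) (η := η) (l := fun w => w.1) (w := w)
    (v := (1, 0, -(w.2.1) / 2)) hδ hf contDiff_fst contDiff_kaplanFourX1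
    (by rw [fderiv_kaplanFour, kaplanFourX1]; ring)
    (by rw [fderiv_fst]; rfl)
  have e2 := fderiv_hardyField (q := q) (η := η) (l := fun w => w.2.1) (w := w)
    (v := (0, 1, w.1 / 2)) hδ hf (by fun_prop) contDiff_kaplanFourX2
    (by rw [fderiv_kaplanFour, kaplanFourX2]; ring)
    (by rw [(hasFDerivAt_snd.fst).fderiv]; rfl)
  rw [← X1, ← X1] at e1
  rw [← X2, ← X2] at e2
  rw [e1, e2, fderiv_kaplanFourX1, fderiv_kaplanFourX2]
  have hK := laplacian_sub_gradient_le (m := kaplanFour w) (s := w.1 ^ 2 + w.2.1 ^ 2)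
    hq hδ hδ1 (by positivity) (by unfold kaplanFour; nlinarith [sq_nonneg w.2.2])
  have hP : kaplanFourX1 w ^ 2 + kaplanFourX2 w ^ 2
      = 16 * (w.1 ^ 2 + w.2.1 ^ 2) * kaplanFour w := by
    unfold kaplanFourX1 kaplanFourX2 kaplanFour; ring
  have hL : 4 * (1 : ℝ) * (w.1 ^ 2 + w.2.1 ^ 2) + 8 * w.1 * (w.1 * 1 + w.2.1 * 0)
      - 16 * (0 * w.2.2 + w.2.1 * (-(w.2.1) / 2))
      + (4 * (1 : ℝ) * (w.1 ^ 2 + w.2.1 ^ 2) + 8 * w.2.1 * (w.1 * 0 + w.2.1 * 1)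
      + 16 * (0 * w.2.2 + w.1 * (w.1 / 2))) = 24 * (w.1 ^ 2 + w.2.1 ^ 2) := by ring
  have hpt := sq_le_of_laplacian_sub_gradient_le (g := f w) (a := X1 f w) (b := X2 f w)
    (x := w.1) (y := w.2.1) (V₁ := q * (kaplanFour w + δ) ^ (q - 1) * kaplanFourX1 w)
    (V₂ := q * (kaplanFour w + δ) ^ (q - 1) * kaplanFourX2 w)
    (L₁ := q * (q - 1) * (kaplanFour w + δ) ^ (q - 2) * kaplanFourX1 w ^ 2
      + q * (kaplanFour w + δ) ^ (q - 1) *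
        (4 * (1 : ℝ) * (w.1 ^ 2 + w.2.1 ^ 2) + 8 * w.1 * (w.1 * 1 + w.2.1 * 0)
          - 16 * (0 * w.2.2 + w.2.1 * (-(w.2.1) / 2))))
    (L₂ := q * (q - 1) * (kaplanFour w + δ) ^ (q - 2) * kaplanFourX2 w ^ 2
      + q * (kaplanFour w + δ) ^ (q - 1) *
        (4 * (1 : ℝ) * (w.1 ^ 2 + w.2.1 ^ 2) + 8 * w.2.1 * (w.1 * 0 + w.2.1 * 1)
          + 16 * (0 * w.2.2 + w.1 * (w.1 / 2)))) hη hηK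
    (by
      refine le_trans (le_of_eq ?_) hK
      rw [← hP, ← hL]
      ring)
  have := mul_le_mul_of_nonneg_right hpt (Real.exp_pos (-(kaplanFour w + δ) ^ q)).le
  refine this.trans_eq ?_
  ring

lemma integrable_mul_exp {h : ℝ × ℝ × ℝ → ℝ} {q : ℝ} (hq : 0 ≤ q) (δ : ℝ) (hh : Continuous h)
    (hc : HasCompactSupport h) :
    Integrable fun w => h w * Real.exp (-(kaplanFour w + δ) ^ q) :=
  (hh.mul (continuous_exp_neg_kaplanFour_rpow hq δ)).integrable_of_hasCompactSupport hc.mul_right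

/-- The Hardy inequality for the weight `exp (-(N⁴ + δ) ^ q)`. -/
lemma integral_sq_mul_exp_le {q δ η : ℝ} (hq : 1 / 2 < q) (hδ : 0 < δ) (hδ1 : δ ≤ 1)
    (hη : 0 < η) (hηK : η * ((256 : ℝ) ^ (q - 1 / 2) * (12 * q + 8 * q ^ 2)) ≤ 1)
    {f : ℝ × ℝ × ℝ → ℝ} (hf : ContDiff ℝ 1 f) (hc : HasCompactSupport f) :
    ∫ w, f w ^ 2 * Real.exp (-(kaplanFour w + δ) ^ q) ≤
      η * (∫ w, (X1 f w ^ 2 + X2 f w ^ 2) * Real.exp (-(kaplanFour w + δ) ^ q))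
      + η⁻¹ * (∫ w, ((w.1 ^ 2 + w.2.1 ^ 2) * f w ^ 2) *
        Real.exp (-(kaplanFour w + δ) ^ q)) := by
  have hH1 := contDiff_hardyField (q := q) (η := η) (l := fun w => w.1) hδ hf contDiff_fst
    contDiff_kaplanFourX1
  have hH2 := contDiff_hardyField (q := q) (η := η) (l := fun w => w.2.1) hδ hf (by fun_prop)
    contDiff_kaplanFourX2
  have hc1 := hasCompactSupport_hardyField (q := q) (δ := δ) (η := η) (l := fun w => w.1)
    (P := kaplanFourX1) hc
  have hc2 := hasCompactSupport_hardyField (q := q) (δ := δ) (η := η) (l := fun w => w.2.1)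
    (P := kaplanFourX2) hc
  have i1 := (continuous_X1 hH1).integrable_of_hasCompactSupport (μ := volume)
    (hasCompactSupport_X1 hc1)
  have i2 := (continuous_X2 hH2).integrable_of_hasCompactSupport (μ := volume)
    (hasCompactSupport_X2 hc2)
  have hq0 : 0 ≤ q := by linarith
  have i0 := integrable_mul_exp hq0 δ (continuous_sq hf) (hasCompactSupport_sq hc)
  have i3 := (integrable_mul_exp hq0 δ (continuous_gradSq hf)
    (hasCompactSupport_gradSq hc)).const_mul η
  have i4 := (integrable_mul_exp hq0 δ (continuous_normSq_mul_sq hf)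
    (hasCompactSupport_normSq_mul_sq hc)).const_mul η⁻¹
  refine (integral_mono i0 (((i1.add i2).add i3).add i4)
    (sq_mul_exp_le hq hδ hδ1 hη hηK hf)).trans_eq ?_
  rw [integral_add' ((i1.add i2).add i3) i4, integral_add' (i1.add i2) i3, integral_add' i1 i2,
    integral_X1_eq_zero hH1 hc1, integral_X2_eq_zero hH2 hc2, integral_const_mul,
    integral_const_mul]
  ring

lemma tendsto_integral_mul_exp {h : ℝ × ℝ × ℝ → ℝ} {q : ℝ} (hq : 0 ≤ q) (hh : Continuous h)
    (hc : HasCompactSupport h) :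
    Filter.Tendsto (fun n : ℕ => ∫ w, h w * Real.exp (-(kaplanFour w + 1 / ((n : ℝ) + 1)) ^ q))
      Filter.atTop (nhds (∫ w, h w * Real.exp (-kaplanFour w ^ q))) := by
  refine tendsto_integral_of_dominated_convergence (fun w => ‖h w‖)
    (fun n => (integrable_mul_exp hq _ hh hc).aestronglyMeasurable)
    (hh.integrable_of_hasCompactSupport hc).norm (fun n => .of_forall fun w => ?_)
    (.of_forall fun w => ?_)
  · rw [norm_mul, Real.norm_of_nonneg (Real.exp_pos _).le]
    refine mul_le_of_le_one_right (norm_nonneg _) (Real.exp_le_one_iff.2 (neg_nonpos.2 ?_))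
    have := kaplanFour_nonneg w
    positivity
  · have h0 : Filter.Tendsto (fun n : ℕ => kaplanFour w + 1 / ((n : ℝ) + 1)) Filter.atTop
        (nhds (kaplanFour w)) := by
      simpa using tendsto_one_div_add_atTop_nhds_zero_nat.const_add (kaplanFour w)
    exact ((Real.continuous_exp.tendsto _).comp (h0.rpow_const (Or.inr hq)).neg).const_mul _

lemma integral_muH (p : ℝ) (hp : 0 ≤ p) (F : ℝ × ℝ × ℝ → ℝ) :
    ∫ w, F w ∂(muH p) = (∫ v : ℝ × ℝ × ℝ, Real.exp (-(KaplanH v) ^ p))⁻¹ *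
      ∫ w, F w * Real.exp (-kaplanFour w ^ (p / 4)) := by
  have hZ : 0 ≤ (∫ v : ℝ × ℝ × ℝ, Real.exp (-(KaplanH v) ^ p))⁻¹ :=
    inv_nonneg.2 (integral_nonneg fun _ => (Real.exp_pos _).le)
  have hcont : Continuous fun w => Real.exp (-(KaplanH w) ^ p) := by
    simp_rw [kaplanH_rpow]
    simpa using continuous_exp_neg_kaplanFour_rpow (q := p / 4) (by positivity) 0
  rw [muH, integral_withDensity_eq_integral_toReal_smul
    (hcont.measurable.const_mul _).ennreal_ofReal (.of_forall fun _ => ENNReal.ofReal_lt_top),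
    ← integral_const_mul]
  congr 1 with w
  rw [ENNReal.toReal_ofReal (mul_nonneg hZ (Real.exp_pos _).le), kaplanH_rpow, smul_eq_mul]
  ring

/-- Dimension-free Hardy-type inequality on the Heisenberg group for
`dμ = Z⁻¹ e^{-N^p} dξ`, `p > 2`:
`∫ f² dμ ≤ C(ε ∫ |∇_ℍ f|² dμ + ε⁻¹ ∫ |x|² f² dμ)` for all `ε ∈ (0,1]`. -/
theorem hardy_L2_heisenberg (p : ℝ) (hp : 2 < p) :
    ∃ C > 0, ∀ ε : ℝ, ε ∈ Set.Ioc (0 : ℝ) 1 →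
      ∀ f : ℝ × ℝ × ℝ → ℝ, ContDiff ℝ (⊤ : ℕ∞) f → HasCompactSupport f →
      ∫ w, (f w) ^ 2 ∂(muH p) ≤
        C * (ε * (∫ w, (X1 f w) ^ 2 + (X2 f w) ^ 2 ∂(muH p)) +
             ε⁻¹ * (∫ w, (w.1 ^ 2 + w.2.1 ^ 2) * (f w) ^ 2 ∂(muH p))) := by
  set q := p / 4 with hqp
  have hq : 1 / 2 < q := by linarith
  have hq0 : 0 ≤ q := by linarith
  set K := (256 : ℝ) ^ (q - 1 / 2) * (12 * q + 8 * q ^ 2) with hK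
  have hK1 : 1 ≤ K := one_le_mul_of_one_le_of_one_le
    (Real.one_le_rpow (by norm_num) (by linarith)) (by nlinarith)
  have hK0 : 0 < K := by linarith
  refine ⟨K, hK0, fun ε hε f hf hc => ?_⟩
  have hf1 : ContDiff ℝ 1 f := hf.of_le (by exact_mod_cast le_top)
  have hη : 0 < ε / K := div_pos hε.1 hK0
  have hηK : ε / K * K ≤ 1 := by rw [div_mul_cancel₀ _ hK0.ne']; exact hε.2
  have main := le_of_tendsto_of_tendsto'
    (tendsto_integral_mul_exp hq0 (continuous_sq hf1) (hasCompactSupport_sq hc))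
    (((tendsto_integral_mul_exp hq0 (continuous_gradSq hf1)
      (hasCompactSupport_gradSq hc)).const_mul (ε / K)).add
      ((tendsto_integral_mul_exp hq0 (continuous_normSq_mul_sq hf1)
        (hasCompactSupport_normSq_mul_sq hc)).const_mul (ε / K)⁻¹))
    fun n => integral_sq_mul_exp_le hq (by positivity)
      (by rw [div_le_one (by positivity)]; linarith [(Nat.cast_nonneg n : (0 : ℝ) ≤ n)])
      hη hηK hf1 hc
  simp_rw [integral_muH p (by linarith), ← hqp]
  set Z := (∫ v : ℝ × ℝ × ℝ, Real.exp (-(KaplanH v) ^ p))⁻¹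
  have hZ : 0 ≤ Z := inv_nonneg.2 (integral_nonneg fun _ => (Real.exp_pos _).le)
  have hA : 0 ≤ ∫ w, (X1 f w ^ 2 + X2 f w ^ 2) * Real.exp (-kaplanFour w ^ q) :=
    integral_nonneg fun w => by positivity
  set A := ∫ w, (X1 f w ^ 2 + X2 f w ^ 2) * Real.exp (-kaplanFour w ^ q)
  set B := ∫ w, ((w.1 ^ 2 + w.2.1 ^ 2) * f w ^ 2) * Real.exp (-kaplanFour w ^ q)
  have hεK : ε / K ≤ K * ε := by
    rw [div_le_iff₀ hK0]
    nlinarith [mul_le_mul hK1 hK1 zero_le_one hK0.le, hε.1]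
  calc _ ≤ Z * (ε / K * A + (ε / K)⁻¹ * B) := by gcongr
    _ ≤ Z * (K * ε * A + (ε / K)⁻¹ * B) := by gcongr
    _ = _ := by rw [inv_div]; ring
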